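/- Central limit tail bound (index form): let a be a probability vector of dimension d with V(a) > 0, and for x ∈ ℝ set k_n(x) := ⌊exp(n·H(a) + x·√(n·V(a)))⌋. Then for every x ∈ ℝ, lim_{n→∞} Σ_{i=1}^{k_n(x)} (a^{⊗n})↓_i = Φ(x), where (a^{⊗n})↓ denotes the entries of a^{⊗n} arranged in non-increasing order. -/

import Mathlib

open Finset Filter

noncomputable section

/-- A probability vector: nonnegative entries summing to 1. -/
def IsProbVec {ι : Type*} [Fintype ι] (p : ι → ℝ) : Prop :=
  (∀ i, 0 ≤ p i) ∧ ∑ i, p i = 1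

/-- The sum of the `k` largest entries of `p`: the largest sum over subsets of at
most `k` indices (for nonnegative vectors this equals the sorted partial sum,
with zero padding beyond the dimension). -/
def kMaxSum {ι : Type*} [Fintype ι] (p : ι → ℝ) (k : ℕ) : ℝ :=
  (Finset.univ.powerset.filter (fun s : Finset ι => s.card ≤ k)).sup'
    ⟨∅, by simp⟩ (fun s => ∑ i ∈ s, p i)

/-- `p ≻ q`: for every `k`, the sum of the `k` largest entries of `p` is at least
that of `q` (dimensions may differ, the shorter padded with zeros). -/
def Majorises {ι κ : Type*} [Fintype ι] [Fintype κ] (p : ι → ℝ) (q : κ → ℝ) : Prop :=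
  ∀ k : ℕ, kMaxSum q k ≤ kMaxSum p k

/-- Fidelity `F(p,q) = (Σ_i √(p_i q_i))²`. -/
def fidelity {ι : Type*} [Fintype ι] (p q : ι → ℝ) : ℝ :=
  (∑ i, Real.sqrt (p i * q i)) ^ 2

/-- Infidelity `δ(p,q) = 1 - F(p,q)`. -/
def infid {ι : Type*} [Fintype ι] (p q : ι → ℝ) : ℝ := 1 - fidelity p q

/-- The `n`-fold tensor (Kronecker) power of `a`, as a vector indexed by
`Fin n → Fin d` (a probability vector of dimension `d^n`). -/
def tensorPow {d : ℕ} (a : Fin d → ℝ) (n : ℕ) : (Fin n → Fin d) → ℝ :=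
  fun f => ∏ j, a (f j)

/-- Shannon entropy `H(p) = -Σ_i p_i log p_i`. -/
def shannonH {ι : Type*} [Fintype ι] (p : ι → ℝ) : ℝ := -∑ i, p i * Real.log (p i)

/-- Entropy variance `V(p) = Σ_i p_i (-log p_i - H(p))²`. -/
def entVar {ι : Type*} [Fintype ι] (p : ι → ℝ) : ℝ :=
  ∑ i, p i * (-Real.log (p i) - shannonH p) ^ 2

/-- Relative entropy to the uniform distribution: `D(p) = log d - H(p)`. -/
def relD {d : ℕ} (p : Fin d → ℝ) : ℝ := Real.log d - shannonH p

/-- Density of the normal distribution with mean `μ` and variance `v`. -/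
def normPDF (μ v x : ℝ) : ℝ :=
  Real.exp (-((x - μ) ^ 2) / (2 * v)) / Real.sqrt (2 * Real.pi * v)

/-- Cumulative distribution function `Φ_{μ,v}` of the normal distribution. -/
def normCDF (μ v x : ℝ) : ℝ := ∫ t in Set.Iic x, normPDF μ v t

/-- The standard normal cumulative distribution function `Φ`. -/
def Phi (x : ℝ) : ℝ := normCDF 0 1 x

lemma IsProbVec.isProbVec_tensorPow {d : ℕ} {a : Fin d → ℝ} (ha : IsProbVec a) (n : ℕ) :
    IsProbVec (tensorPow a n) := by
  refine ⟨fun f ↦ Finset.prod_nonneg fun j _ ↦ ha.1 _, ?_⟩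
  have h := (Finset.prod_univ_sum (fun _ : Fin n ↦ (Finset.univ : Finset (Fin d)))
    fun _ i ↦ a i).symm
  simpa [tensorPow, ha.2] using h

section PointMass

open MeasureTheory ProbabilityTheory

/-- The measure on a finite type with point masses `p i`. -/
def pointMassMeasure {ι : Type*} [Fintype ι] [MeasurableSpace ι] (p : ι → ℝ) : Measure ι :=
  ∑ i, ENNReal.ofReal (p i) • Measure.dirac i

variable {ι : Type*} [Fintype ι] [MeasurableSpace ι] {p : ι → ℝ}

lemma pointMassMeasure_singleton [MeasurableSingletonClass ι] (p : ι → ℝ) (i : ι) :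
    pointMassMeasure p {i} = ENNReal.ofReal (p i) := by
  classical
  simp [pointMassMeasure, Measure.finsetSum_apply, Set.indicator_apply]

lemma IsProbVec.isProbabilityMeasure (hp : IsProbVec p) :
    IsProbabilityMeasure (pointMassMeasure p) where
  measure_univ := by
    simp [pointMassMeasure, Measure.finsetSum_apply,
      ← ENNReal.ofReal_sum_of_nonneg fun i _ ↦ hp.1 i, hp.2]

lemma IsProbVec.integral_pointMassMeasure [MeasurableSingletonClass ι] (hp : IsProbVec p)
    (g : ι → ℝ) :
    ∫ i, g i ∂pointMassMeasure p = ∑ i, p i * g i := by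
  have := hp.isProbabilityMeasure
  rw [integral_fintype .of_finite]
  simp [measureReal_def, pointMassMeasure_singleton, hp.1]

lemma infinitePi_pointMassMeasure_preimage {d : ℕ} {a : Fin d → ℝ} (ha : IsProbVec a) (n : ℕ)
    (s : Finset (Fin n → Fin d)) :
    (Measure.infinitePi fun _ : ℕ ↦ pointMassMeasure a) {ω | (fun j : Fin n ↦ ω j) ∈ s} =
      ENNReal.ofReal (∑ f ∈ s, tensorPow a n f) := by
  have := ha.isProbabilityMeasure
  have hmap := Measure.map_infinitePi_infinitePi_of_inj (P := fun _ : ℕ ↦ pointMassMeasure a)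
    (f := (Fin.val : Fin n → ℕ)) Fin.val_injective
  rw [Measure.infinitePi_eq_pi (ι := Fin n)] at hmap
  have hs : {ω : ℕ → Fin d | (fun j : Fin n ↦ ω j) ∈ s} =
      (fun ω (j : Fin n) ↦ ω j) ⁻¹' (s : Set (Fin n → Fin d)) := rfl
  rw [hs, ← Measure.map_apply (by fun_prop) s.measurableSet, hmap, ← sum_measure_singleton,
    ENNReal.ofReal_sum_of_nonneg fun f _ ↦ (ha.isProbVec_tensorPow n).1 f]
  refine Finset.sum_congr rfl fun f _ ↦ ?_
  simp [pointMassMeasure_singleton, tensorPow, ENNReal.ofReal_prod_of_nonneg, ha.1]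

lemma Phi_eq_gaussianReal (x : ℝ) : Phi x = (gaussianReal 0 1).real (Set.Iic x) := by
  rw [measureReal_def, gaussianReal_apply_eq_integral 0 one_ne_zero,
    ENNReal.toReal_ofReal (integral_nonneg fun _ ↦ gaussianPDFReal_nonneg _ _ _), Phi, normCDF]
  congr with t
  simp [normPDF, gaussianPDFReal, div_eq_inv_mul]

lemma exists_pos_Phi_add_lt {x c : ℝ} (hc : Phi x < c) : ∃ ε > 0, Phi (x + ε) < c := by
  have hcdf (y : ℝ) : Phi y = cdf (gaussianReal 0 1) y := by
    rw [Phi_eq_gaussianReal, cdf_eq_real]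
  have hev : ∀ᶠ y in nhdsWithin x (Set.Ici x), Phi y < c := by
    simp only [hcdf] at hc ⊢
    exact ((cdf (gaussianReal 0 1)).right_continuous x).eventually_lt_const hc
  obtain ⟨y, hy, hyx⟩ := ((hev.filter_mono (nhdsWithin_mono x Set.Ioi_subset_Ici_self)).and
    self_mem_nhdsWithin).exists
  exact ⟨y - x, sub_pos.2 hyx, by simpa using hy⟩

/-- The central limit theorem for the product measure `a^{⊗n}` and a normalised function `g`. -/
lemma IsProbVec.tendsto_sum_tensorPow {d : ℕ} {a : Fin d → ℝ} (ha : IsProbVec a) {g : Fin d → ℝ}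
    (h0 : ∑ i, a i * g i = 0) (h1 : ∑ i, a i * g i ^ 2 = 1) (t : ℝ) :
    Tendsto (fun n : ℕ ↦ ∑ f : Fin n → Fin d with (√n)⁻¹ * ∑ j, g (f j) ≤ t, tensorPow a n f)
      atTop (nhds (Phi t)) := by
  have := ha.isProbabilityMeasure
  set P := Measure.infinitePi fun _ : ℕ ↦ pointMassMeasure a
  have hg : Measurable g := .of_discrete
  have heval (k : ℕ) : MeasurePreserving (fun ω : ℕ → Fin d ↦ ω k) P (pointMassMeasure a) :=
    measurePreserving_eval_infinitePi _ k
  have hint (h : Fin d → ℝ) (k : ℕ) : ∫ ω, h (ω k) ∂P = ∑ i, a i * h i := by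
    rw [← ha.integral_pointMassMeasure, ← (heval k).map_eq,
      integral_map (heval k).aemeasurable (Measurable.of_discrete.aestronglyMeasurable)]
  have hclt := tendstoInDistribution_inv_sqrt_mul_sum (P := P) (X := fun k ω ↦ g (ω k))
    (HasLaw.id (μ := gaussianReal 0 1)) ((hint g 0).trans h0)
    ((hint (fun i ↦ g i ^ 2) 0).trans h1) (iIndepFun_infinitePi fun _ ↦ hg)
    fun k ↦ by
      refine ⟨(hg.comp (measurable_pi_apply k)).aemeasurable,
        (hg.comp (measurable_pi_apply 0)).aemeasurable, ?_⟩
      have hk (k : ℕ) : P.map (fun ω ↦ g (ω k)) = (pointMassMeasure a).map g := by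
        rw [← (heval k).map_eq, Measure.map_map hg (heval k).measurable]
        rfl
      rw [hk, hk]
  have hfr : gaussianReal 0 1 (frontier (Set.Iic t)) = 0 := by
    have := nullSingletonClass_gaussianReal (μ := 0) one_ne_zero
    simp
  have hlim := ProbabilityMeasure.tendsto_measure_of_null_frontier_of_tendsto' hclt.tendsto
    (E := Set.Iic t) (by simpa using hfr)
  simp only [ProbabilityMeasure.coe_mk, Measure.map_id] at hlim
  rw [Phi_eq_gaussianReal]
  refine ((ENNReal.tendsto_toReal (measure_ne_top _ _)).comp hlim).congr fun n ↦ ?_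
  rw [Function.comp_apply, Measure.map_apply (by fun_prop) measurableSet_Iic, ← ENNReal.toReal_ofReal
    (Finset.sum_nonneg fun f _ ↦ (ha.isProbVec_tensorPow n).1 f :
      0 ≤ ∑ f : Fin n → Fin d with (√n)⁻¹ * ∑ j, g (f j) ≤ t, tensorPow a n f),
    ← infinitePi_pointMassMeasure_preimage ha]
  congr 2
  ext ω
  simp [Finset.sum_range]

end PointMass

section kMaxSum

variable {ι : Type*} [Fintype ι] {p : ι → ℝ} {k : ℕ}

lemma le_kMaxSum {s : Finset ι} (hs : s.card ≤ k) : ∑ i ∈ s, p i ≤ kMaxSum p k :=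
  Finset.le_sup' (fun s : Finset ι ↦ ∑ i ∈ s, p i) (by simpa using hs)

lemma kMaxSum_le {c : ℝ} (h : ∀ s : Finset ι, s.card ≤ k → ∑ i ∈ s, p i ≤ c) :
    kMaxSum p k ≤ c :=
  Finset.sup'_le _ _ fun s hs ↦ h s (by simpa using hs)

/-- The entries of `p` that are at least `1 / M` are captured by its `⌊M⌋` largest entries. -/
lemma IsProbVec.sum_filter_le_kMaxSum (hp : IsProbVec p) {M : ℝ} (hM : 0 < M) :
    ∑ i with M⁻¹ ≤ p i, p i ≤ kMaxSum p ⌊M⌋₊ := by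
  refine le_kMaxSum (Nat.le_floor ?_)
  have h : (Finset.card {i | M⁻¹ ≤ p i} : ℝ) * M⁻¹ ≤ 1 := by
    rw [← nsmul_eq_mul]
    exact (Finset.card_nsmul_le_sum _ _ _ (by simp)).trans
      ((Finset.sum_le_univ_sum_of_nonneg hp.1).trans hp.2.le)
  rwa [← div_eq_mul_inv, div_le_one hM] at h

/-- Entries smaller than `1 / L` contribute at most `k / L` to the sum of the `k` largest ones. -/
lemma IsProbVec.kMaxSum_le_sum_filter_add (hp : IsProbVec p) {L : ℝ} (hL : 0 < L) :
    kMaxSum p k ≤ ∑ i with L⁻¹ ≤ p i, p i + k / L := by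
  classical
  refine kMaxSum_le fun s hs ↦ ?_
  rw [← Finset.sum_filter_add_sum_filter_not s (fun i ↦ L⁻¹ ≤ p i)]
  refine add_le_add (Finset.sum_le_sum_of_subset_of_nonneg
    (Finset.filter_subset_filter _ (Finset.subset_univ s)) fun i _ _ ↦ hp.1 i) ?_
  calc ∑ i ∈ s with ¬ L⁻¹ ≤ p i, p i
      ≤ (Finset.card {i ∈ s | ¬ L⁻¹ ≤ p i}) • L⁻¹ :=
        Finset.sum_le_card_nsmul _ _ _ fun i hi ↦ (not_le.1 (Finset.mem_filter.1 hi).2).le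
    _ ≤ k / L := by
        rw [nsmul_eq_mul, ← div_eq_mul_inv]
        gcongr
        exact (Finset.card_filter_le _ _).trans hs

end kMaxSum

/-- The entries of `a^{⊗n}` that are at least `exp (-(n H(a) + t √(n V(a))))` carry mass `Φ(t)`
in the limit. -/
lemma IsProbVec.tendsto_sum_tensorPow_ge {d : ℕ} {a : Fin d → ℝ} (ha : IsProbVec a)
    (hV : 0 < entVar a) (t : ℝ) :
    Tendsto (fun n : ℕ ↦
      ∑ f with (Real.exp (n * shannonH a + t * √(n * entVar a)))⁻¹ ≤ tensorPow a n f,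
        tensorPow a n f) atTop (nhds (Phi t)) := by
  have h0 : ∑ i, a i * ((-Real.log (a i) - shannonH a) / √(entVar a)) = 0 := by
    simp_rw [← mul_div_assoc, ← Finset.sum_div, mul_sub, Finset.sum_sub_distrib,
      ← Finset.sum_mul, ha.2]
    simp [shannonH]
  have h1 : ∑ i, a i * ((-Real.log (a i) - shannonH a) / √(entVar a)) ^ 2 = 1 := by
    simp_rw [div_pow, Real.sq_sqrt hV.le, ← mul_div_assoc, ← Finset.sum_div]
    exact div_self hV.ne'
  refine (ha.tendsto_sum_tensorPow h0 h1 t).congr' ?_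
  filter_upwards [eventually_gt_atTop 0] with n hn
  rw [Finset.sum_filter, Finset.sum_filter]
  refine Finset.sum_congr rfl fun f _ ↦ ?_
  obtain hf | hf := ((ha.isProbVec_tensorPow n).1 f).eq_or_lt
  · simp [← hf]
  have hne (j : Fin n) : a (f j) ≠ 0 := fun h ↦ hf.ne' (Finset.prod_eq_zero (mem_univ j) h)
  have hlog : Real.log (tensorPow a n f) = ∑ j, Real.log (a (f j)) :=
    Real.log_prod fun j _ ↦ hne j
  have hn' : (0 : ℝ) < √n := Real.sqrt_pos.2 (by exact_mod_cast hn)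
  have hV' : 0 < √(entVar a) := Real.sqrt_pos.2 hV
  refine if_congr ?_ rfl rfl
  rw [← Real.exp_neg, ← Real.le_log_iff_exp_le hf, hlog, Real.sqrt_mul n.cast_nonneg,
    ← Finset.sum_div, inv_mul_le_iff₀ hn', div_le_iff₀ hV', Finset.sum_sub_distrib,
    Finset.sum_neg_distrib]
  simp only [Finset.sum_const, Finset.card_univ, Fintype.card_fin, nsmul_eq_mul]
  constructor <;> intro h <;> linarith

/-- central limit tail bound (index form): the sum of the
`k_n(x) = ⌊exp(n H(a) + x √(n V(a)))⌋` largest entries of `a^{⊗n}` converges to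
`Φ(x)`. -/
theorem clt_tail_index
    {d : ℕ} (a : Fin d → ℝ) (ha : IsProbVec a) (hV : 0 < entVar a) (x : ℝ) :
    Filter.Tendsto (fun n : ℕ =>
      kMaxSum (tensorPow a n)
        ⌊Real.exp (n * shannonH a + x * Real.sqrt (n * entVar a))⌋₊)
      Filter.atTop (nhds (Phi x)) := by
  refine tendsto_order.2 ⟨fun c hc ↦ ?_, fun c hc ↦ ?_⟩
  · filter_upwards [(ha.tendsto_sum_tensorPow_ge hV x).eventually_const_lt hc] with n hn
    exact hn.trans_le ((ha.isProbVec_tensorPow n).sum_filter_le_kMaxSum (Real.exp_pos _))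
  · obtain ⟨ε, hε, hεc⟩ := exists_pos_Phi_add_lt hc
    have hsqrt : Tendsto (fun n : ℕ ↦ ε * √(n * entVar a)) atTop atTop :=
      (Real.tendsto_sqrt_atTop.comp
        (tendsto_natCast_atTop_atTop.atTop_mul_const hV)).const_mul_atTop hε
    have hlim := (ha.tendsto_sum_tensorPow_ge hV (x + ε)).add
      (Real.tendsto_exp_neg_atTop_nhds_zero.comp hsqrt)
    rw [add_zero] at hlim
    filter_upwards [hlim.eventually_lt_const hεc] with n hn
    refine ((ha.isProbVec_tensorPow n).kMaxSum_le_sum_filter_add (Real.exp_pos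
      (n * shannonH a + (x + ε) * √(n * entVar a)))).trans_lt (lt_of_le_of_lt ?_ hn)
    refine add_le_add le_rfl ?_
    rw [div_le_iff₀ (Real.exp_pos _), Function.comp_apply, ← Real.exp_add]
    refine (Nat.floor_le (Real.exp_pos _).le).trans (Real.exp_le_exp.2 (le_of_eq ?_))
    ring
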